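/- Let A₁ be the first Weyl algebra over a field K of characteristic zero. There exist no elements P, Q ∈ A₁ with [P,Q] = 1 such that m(P) = 1, m(Q) = 2, and P ∉ A_{1,≤1} (i.e., P has total degree at least 2 in X and Y). -/

import Mathlib

open Polynomial

noncomputable section

variable (K : Type) [Field K] [CharZero K]

/-- Defining relation of the first Weyl algebra: `Y*X = X*Y + 1`, i.e. `[Y,X] = 1`
(`true` encodes `X`, `false` encodes `Y`). -/
inductive WeylRel : FreeAlgebra K Bool → FreeAlgebra K Bool → Prop
  | comm : WeylRel (FreeAlgebra.ι K false * FreeAlgebra.ι K true)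
      (FreeAlgebra.ι K true * FreeAlgebra.ι K false + 1)

/-- The first Weyl algebra `A₁ = K⟨X,Y | YX - XY = 1⟩`. -/
abbrev Weyl : Type := RingQuot (WeylRel K)

/-- The generator `X` of the Weyl algebra. -/
def Wx : Weyl K := RingQuot.mkAlgHom K (WeylRel K) (FreeAlgebra.ι K true)

/-- The generator `Y` of the Weyl algebra. -/
def Wy : Weyl K := RingQuot.mkAlgHom K (WeylRel K) (FreeAlgebra.ι K false)

/-- The element `H = Y*X`. -/
def WH : Weyl K := Wy K * Wx K

/-- `X^n` for `n ≥ 0` and `Y^{-n}` for `n < 0`. -/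
def weight (n : ℤ) : Weyl K := if 0 ≤ n then Wx K ^ n.toNat else Wy K ^ (-n).toNat

/-- The `n`-th homogeneous component `A_{1,n}` of the `ℤ`-grading of the Weyl algebra:
`K[H]·Xⁿ` for `n ≥ 0` and `K[H]·Y^{-n}` for `n < 0`. -/
def component (n : ℤ) : Submodule K (Weyl K) :=
  LinearMap.range ((LinearMap.mulRight K (weight K n)).comp
    (Polynomial.aeval (WH K)).toLinearMap)

def opX : Module.End K (ℤ → K) where
  toFun f n := f (n - 1)
  map_add' _ _ := rfl
  map_smul' _ _ := rfl

def opY : Module.End K (ℤ → K) where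
  toFun f n := ((n : K) + 1) * f (n + 1)
  map_add' f g := by ext n; simp [mul_add]
  map_smul' c f := by ext n; simp; ring

def wrep : Weyl K →ₐ[K] Module.End K (ℤ → K) :=
  RingQuot.liftAlgHom K ⟨FreeAlgebra.lift K (fun b => if b then opX K else opY K), by
    intro x y h
    cases h
    simp only [map_mul, map_add, map_one, FreeAlgebra.lift_ι_apply]
    ext1 f
    ext n
    simp [opX, opY]
    ring⟩

lemma wrep_X : wrep K (Wx K) = opX K := by
  simp [wrep, Wx, RingQuot.liftAlgHom_mkAlgHom_apply]

lemma wrep_Y : wrep K (Wy K) = opY K := by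
  simp [wrep, Wy, RingQuot.liftAlgHom_mkAlgHom_apply]

lemma wrep_H (f : ℤ → K) (n : ℤ) : wrep K (WH K) f n = ((n : K) + 1) * f n := by
  simp [WH, wrep_X, wrep_Y, opX, opY]

lemma wrep_poly (p : K[X]) : ∀ (f : ℤ → K) (n : ℤ),
    wrep K (aeval (WH K) p) f n = p.eval ((n : K) + 1) * f n := by
  induction p using Polynomial.induction_on' with
  | add p q hp hq => intro f n; simp [hp, hq, add_mul]
  | monomial m c =>
    intro f n
    rw [aeval_monomial, eval_monomial, map_mul, AlgHom.commutes]
    simp only [Module.algebraMap_end_eq_smul_id, Module.End.mul_apply, LinearMap.smul_apply,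
      LinearMap.id_apply, Pi.smul_apply, smul_eq_mul, mul_assoc]
    congr 1
    induction m with
    | zero => simp
    | succ m ih =>
      rw [pow_succ', map_mul, Module.End.mul_apply, wrep_H, ih, pow_succ']; ring

lemma wrep_Xpow (m : ℕ) : ∀ (f : ℤ → K) (n : ℤ), wrep K (Wx K ^ m) f n = f (n - m) := by
  induction m with
  | zero => simp
  | succ m ih =>
    intro f n
    rw [pow_succ', map_mul, Module.End.mul_apply, wrep_X]
    simp only [opX, LinearMap.coe_mk, AddHom.coe_mk, ih]
    congr 1; push_cast; ring

lemma wrep_Ypow (m : ℕ) : ∃ w : K[X], w ≠ 0 ∧ w.natDegree = m ∧ ∀ (f : ℤ → K) (n : ℤ),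
    wrep K (Wy K ^ m) f n = w.eval (n : K) * f (n + m) := by
  induction m with
  | zero => exact ⟨1, by simp, by simp, by simp⟩
  | succ m ih =>
    obtain ⟨w, h0, hd, hw⟩ := ih
    have hc : w.comp (X + C 1) ≠ 0 := by
      intro h; apply h0
      have := congrArg (fun r => r.comp (X - C 1)) h
      simpa [comp_assoc] using this
    have hx : (X + C 1 : K[X]) ≠ 0 := X_add_C_ne_zero 1
    refine ⟨(X + C 1) * w.comp (X + C 1), mul_ne_zero hx hc, ?_, ?_⟩
    · rw [natDegree_mul hx hc, natDegree_comp, natDegree_X_add_C, hd]; ring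
    · intro f n
      rw [pow_succ', map_mul, Module.End.mul_apply, wrep_Y]
      simp only [opY, LinearMap.coe_mk, AddHom.coe_mk, hw]
      simp only [eval_mul, eval_add, eval_X, eval_C, eval_comp]
      push_cast
      rw [mul_assoc]
      congr 3; ring

lemma comp_rep (i : ℤ) (P : Weyl K) (hP : P ∈ component K i) :
    ∃ p a : K[X], P = aeval (WH K) p * weight K i ∧ (∀ (f : ℤ → K) (n : ℤ),
      wrep K P f n = a.eval (n : K) * f (n - i)) ∧
      (a ≠ 0 → a.natDegree = p.natDegree + (-i).toNat) := by
  obtain ⟨p, rfl⟩ := hP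
  have key : ∃ w : K[X], w ≠ 0 ∧ w.natDegree = (-i).toNat ∧ ∀ (f : ℤ → K) (n : ℤ),
      wrep K (weight K i) f n = w.eval (n : K) * f (n - i) := by
    unfold weight
    split_ifs with h
    · refine ⟨1, one_ne_zero, by simp; omega, fun f n => ?_⟩
      rw [wrep_Xpow, Int.toNat_of_nonneg h]; simp
    · obtain ⟨w, h0, hd, hw⟩ := wrep_Ypow K (-i).toNat
      refine ⟨w, h0, hd, fun f n => ?_⟩
      rw [hw, Int.toNat_of_nonneg (by omega)]; rfl
  obtain ⟨w, h0, hd, hw⟩ := key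
  refine ⟨p, p.comp (X + C 1) * w, rfl, ?_, ?_⟩
  · intro f n
    simp only [LinearMap.comp_apply, AlgHom.toLinearMap_apply, LinearMap.mulRight_apply, map_mul,
      Module.End.mul_apply, wrep_poly, hw]
    simp [mul_assoc]
  · intro h
    rw [natDegree_mul (left_ne_zero_of_mul h) h0, natDegree_comp, natDegree_X_add_C, hd, mul_one]

lemma phi_deg (φ : K[X]) (i : ℤ)
    (h : ∀ n : ℤ, φ.eval (n : K) - φ.eval ((n + i : ℤ) : K) = 1) :
    i ≠ 0 ∧ φ.natDegree = 1 := by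
  have hi : i ≠ 0 := by
    rintro rfl
    simpa using h 0
  refine ⟨hi, ?_⟩
  have hk : ∀ k : ℕ, φ.eval (((k : ℤ) * i : ℤ) : K) = φ.eval 0 - k := by
    intro k
    induction k with
    | zero => simp
    | succ k ih =>
      have := h ((k : ℤ) * i)
      rw [ih] at this
      have e : ((k + 1 : ℕ) : ℤ) * i = (k : ℤ) * i + i := by push_cast; ring
      rw [e]; push_cast at this ⊢; linear_combination -this
  have e : φ.comp (C (i : K) * X) = C (φ.eval 0) - X := by
    apply Polynomial.eq_of_infinite_eval_eq
    refine Set.Infinite.mono ?_ (Set.infinite_range_of_injective (Nat.cast_injective (R := K)))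
    rintro _ ⟨k, rfl⟩
    have := hk k
    push_cast at this
    rw [mul_comm] at this
    simp [this]
  have := congrArg natDegree e
  have hiK : (i : K) ≠ 0 := by exact_mod_cast hi
  rw [natDegree_comp, natDegree_C_mul_X _ hiK, mul_one] at this
  rw [this, ← neg_sub, natDegree_neg, natDegree_X_sub_C]

lemma main_case (i : ℤ) (P : Weyl K) (p a r b : K[X]) (hP : P = aeval (WH K) p * weight K i)
    (ha : a ≠ 0 → a.natDegree = p.natDegree + (-i).toNat)
    (hb : b ≠ 0 → b.natDegree = r.natDegree + i.toNat)
    (h : ∀ n : ℤ, a.eval (n : K) * b.eval ((n - i : ℤ) : K)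
      - b.eval (n : K) * a.eval ((n + i : ℤ) : K) = 1) :
    P ∈ Submodule.span K {(1 : Weyl K), Wx K, Wy K} := by
  obtain ⟨hi, hd⟩ := phi_deg K (a * b.comp (X - C (i : K))) i (by
    intro n
    have := h n
    simp at this ⊢
    linear_combination this)
  have hne : a * b.comp (X - C (i : K)) ≠ 0 := by
    intro h0; rw [h0, natDegree_zero] at hd; omega
  have ha0 := left_ne_zero_of_mul hne
  have hb0 : b ≠ 0 := by rintro rfl; simp at hne
  rw [natDegree_mul ha0 (right_ne_zero_of_mul hne), natDegree_comp, natDegree_X_sub_C,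
    ha ha0, hb hb0] at hd
  have hp : p.natDegree = 0 := by omega
  rw [natDegree_eq_zero] at hp
  obtain ⟨c, rfl⟩ := hp
  have : i = 1 ∨ i = -1 := by omega
  rw [hP, aeval_C, ← Algebra.smul_def]
  apply Submodule.smul_mem
  apply Submodule.subset_span
  rcases this with rfl | rfl <;> simp [weight]

/-- **Step (iii) of the proof.** There are no `P, Q ∈ A₁` with `[P,Q] = 1` such that `P` is
homogeneous (mass `1`) of total degree `≥ 2` (i.e. `P ∉ A_{1,≤1} = K + KX + KY`) and `Q` is a
sum of exactly two nonzero homogeneous components (mass `2`). -/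
theorem no_mass_one_two :
    ¬∃ P Q : Weyl K,
      (∃ i : ℤ, P ∈ component K i ∧ P ≠ 0) ∧
      (∃ s q : ℤ, s ≠ q ∧ ∃ Qs ∈ component K s, ∃ Qq ∈ component K q,
        Qs ≠ 0 ∧ Qq ≠ 0 ∧ Q = Qs + Qq) ∧
      P ∉ Submodule.span K {(1 : Weyl K), Wx K, Wy K} ∧
      P * Q - Q * P = 1 := by
  rintro ⟨P, Q, ⟨i, hPi, -⟩, ⟨s, q, hsq, Qs, hQs, Qq, hQq, -, -, rfl⟩, hspan, hcomm⟩
  obtain ⟨p, a, hP, hPa, had⟩ := comp_rep K i P hPi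
  obtain ⟨r, b, -, hb, hbd⟩ := comp_rep K s Qs hQs
  obtain ⟨u, c, -, hc, hcd⟩ := comp_rep K q Qq hQq
  have key : ∀ (f : ℤ → K) (n : ℤ),
      (a.eval (n : K) * b.eval ((n - i : ℤ) : K) - b.eval (n : K) * a.eval ((n - s : ℤ) : K))
        * f (n - i - s)
      + (a.eval (n : K) * c.eval ((n - i : ℤ) : K) - c.eval (n : K) * a.eval ((n - q : ℤ) : K))
        * f (n - i - q) = f n := by
    intro f n
    have := congrFun (congrArg (fun T => wrep K T f) hcomm) n
    simp only [map_sub, map_mul, map_add, map_one, LinearMap.sub_apply, Module.End.mul_apply,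
      LinearMap.add_apply, Pi.sub_apply, Pi.add_apply, Module.End.one_apply, hPa, hb, hc,
      sub_right_comm n s i, sub_right_comm n q i] at this
    linear_combination this
  apply hspan
  by_cases h1 : s = -i
  · subst h1
    refine main_case K i P p a r b hP had (by simpa using hbd) fun n => ?_
    have h2 : n - i - q ≠ n := by omega
    have h3 : n - i - -i = n := by omega
    have := key (Pi.single n 1) n
    rw [h3, Pi.single_eq_same, Pi.single_eq_of_ne h2, sub_neg_eq_add] at this
    simpa using this
  · by_cases h4 : q = -i
    · subst h4
      refine main_case K i P p a u c hP had (by simpa using hcd) fun n => ?_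
      have h2 : n - i - s ≠ n := by omega
      have h3 : n - i - -i = n := by omega
      have := key (Pi.single n 1) n
      rw [h3, Pi.single_eq_same, Pi.single_eq_of_ne h2, sub_neg_eq_add] at this
      simpa using this
    · exfalso
      have := key (Pi.single 0 1) 0
      rw [Pi.single_eq_same, Pi.single_eq_of_ne (by omega), Pi.single_eq_of_ne (by omega)] at this
      simp at this
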